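/- In the concrete model H_Z described below, the family B̂ := {δ̂_1} ∪ {δ̂^i_{j,k} : i = 1,2,3, 1 ≤ j ≤ γ_i − 1, 0 ≤ k ≤ n_i − 1}, consisting of 1 + Σ_{i=1}^3 n_i(γ_i − 1) vectors, is linearly independent over ℚ, and its Gram matrix is star-shaped: ⟨δ̂_1, δ̂_1⟩ = 2j_G − 2; every δ̂^i_{j,k} has self-pairing −2; ⟨δ̂_1, δ̂^i_{1,k}⟩ = 1 and ⟨δ̂^i_{j,k}, δ̂^i_{j+1,k}⟩ = 1; and all other pairs among B̂ pair to 0 (so B̂ spans a subspace on which the form has the Coxeter–Dynkin diagram with center δ̂_1 and, for each i, n_i parallel arms of length γ_i − 1 consisting of (−2)-vectors). -/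

import Mathlib

/-!  The concrete model `H_Z` = orthogonal direct sum of `H_W` (spanned by `δ̄_1` and the
`δ̄^i_j`) and one copy `V^i_j` of the negated `A_{n_i-1}` root space for each `i` with
`n_i > 1` and each `1 ≤ j ≤ γ_i`, together with the vectors
`δ̂_1, δ̂^i_{j,k}` of the star-shaped Coxeter-Dynkin diagram. -/

/-- Index set of the basis `δ̄_1, δ̄^i_j (1 ≤ j ≤ γ_i - 1)` of `H_W`;  `Sum.inl ()` stands
for `δ̄_1` and `Sum.inr ⟨i, j⟩` for `δ̄^i_{j+1}`. -/
abbrev IdxW (γ : Fin 3 → ℕ) : Type := Unit ⊕ (Σ i : Fin 3, Fin (γ i - 1))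

/-- Index set of the basis of `H_Z`:  the basis of `H_W` together with, for each `i` (with
`n_i > 1`) and each `j : Fin (γ i)` (the copy `V^i_{j+1}`), the simple roots
`e^i_{j,k}, k : Fin (n_i - 1)` of the negated `A_{n_i-1}` root space. -/
abbrev IdxZ (nn γ : Fin 3 → ℕ) : Type :=
  IdxW γ ⊕ (Σ i : Fin 3, Fin (γ i) × Fin (nn i - 1))

/-- Gram matrix of the form on `H_W`:  `⟨δ̄_1,δ̄_1⟩ = 2j_G - 2`,
`⟨δ̄^i_j,δ̄^i_j⟩ = -2n_i`, `⟨δ̄_1,δ̄^i_1⟩ = ⟨δ̄^i_j,δ̄^i_{j+1}⟩ = n_i`, all other pairs `0`. -/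
def gramW (nn γ : Fin 3 → ℕ) (jG : ℤ) : IdxW γ → IdxW γ → ℚ
  | Sum.inl _, Sum.inl _ => 2 * (jG : ℚ) - 2
  | Sum.inl _, Sum.inr ⟨i, j⟩ => if j.val = 0 then (nn i : ℚ) else 0
  | Sum.inr ⟨i, j⟩, Sum.inl _ => if j.val = 0 then (nn i : ℚ) else 0
  | Sum.inr ⟨i, j⟩, Sum.inr ⟨i', j'⟩ =>
      if i = i' then
        (if j.val = j'.val then -2 * (nn i : ℚ)
         else if j.val + 1 = j'.val ∨ j'.val + 1 = j.val then (nn i : ℚ) else 0)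
      else 0

/-- Gram matrix of the form on `H_Z`:  the orthogonal direct sum of the form on `H_W` and
the negated `A_{n_i-1}` forms on the copies `V^i_j`. -/
def gramZ (nn γ : Fin 3 → ℕ) (jG : ℤ) : IdxZ nn γ → IdxZ nn γ → ℚ
  | Sum.inl p, Sum.inl q => gramW nn γ jG p q
  | Sum.inl _, Sum.inr _ => 0
  | Sum.inr _, Sum.inl _ => 0
  | Sum.inr ⟨i, j, k⟩, Sum.inr ⟨i', j', k'⟩ =>
      if i = i' ∧ j.val = j'.val then
        (if k.val = k'.val then -2
         else if k.val + 1 = k'.val ∨ k'.val + 1 = k.val then 1 else 0)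
      else 0

/-- The symmetric bilinear form on `H_Z = (IdxZ nn γ → ℚ)`. -/
def formZ (nn γ : Fin 3 → ℕ) (jG : ℤ) (x y : IdxZ nn γ → ℚ) : ℚ :=
  ∑ p : IdxZ nn γ, ∑ q : IdxZ nn γ, x p * y q * gramZ nn γ jG p q

/-- The inclusion `h : H_W → H_Z` of the summand `H_W`. -/
def hIncl (nn γ : Fin 3 → ℕ) (x : IdxW γ → ℚ) : IdxZ nn γ → ℚ :=
  fun p => match p with
  | Sum.inl q => x q
  | Sum.inr _ => 0

/-- The basis vector `δ̄_1` of `H_W`. -/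
def dbar1 (γ : Fin 3 → ℕ) : IdxW γ → ℚ := Pi.single (Sum.inl ()) 1

/-- The basis vector `δ̄^i_{j+1}` of `H_W`, for `j : Fin (γ i - 1)`. -/
def dbarm (γ : Fin 3 → ℕ) (i : Fin 3) (j : Fin (γ i - 1)) : IdxW γ → ℚ :=
  Pi.single (Sum.inr ⟨i, j⟩) 1

/-- The simple root `e^i_{j,k}` in the copy `V^i_j` of the negated `A_{n_i-1}` root space. -/
def rootZ (nn γ : Fin 3 → ℕ) (i : Fin 3) (j : Fin (γ i)) (k : Fin (nn i - 1)) :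
    IdxZ nn γ → ℚ :=
  Pi.single (Sum.inr ⟨i, j, k⟩) 1

/-- The reflection `w_e(x) = x + ⟨x, e⟩·e` in a `(-2)`-vector `e`. -/
def reflZ (nn γ : Fin 3 → ℕ) (jG : ℤ) (e x : IdxZ nn γ → ℚ) : IdxZ nn γ → ℚ :=
  x + formZ nn γ jG x e • e

/-- The first fundamental weight `Λ^i_j = (1/n_i)·Σ_{k=1}^{n_i-1} (n_i - k)·e^i_{j,k}` of
the copy `V^i_j`. -/
def weightZ (nn γ : Fin 3 → ℕ) (i : Fin 3) (j : Fin (γ i)) : IdxZ nn γ → ℚ :=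
  (1 / (nn i : ℚ)) • ∑ k : Fin (nn i - 1), ((nn i : ℚ) - ((k : ℕ) + 1)) • rootZ nn γ i j k

/-- The weights `λ^i_{j,0} := Λ^i_j` and `λ^i_{j,k} := w^i_{j,k} ∘ ⋯ ∘ w^i_{j,1} (Λ^i_j)`
in the copy `V^i_j`. -/
def lamZ (nn γ : Fin 3 → ℕ) (jG : ℤ) (i : Fin 3) (j : Fin (γ i)) : ℕ → (IdxZ nn γ → ℚ)
  | 0 => weightZ nn γ i j
  | k + 1 =>
      if h : k < nn i - 1 then reflZ nn γ jG (rootZ nn γ i j ⟨k, h⟩) (lamZ nn γ jG i j k)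
      else lamZ nn γ jG i j k

/-- `δ̂_1 := h(δ̄_1)`. -/
def dhat1 (nn γ : Fin 3 → ℕ) : IdxZ nn γ → ℚ := hIncl nn γ (dbar1 γ)

/-- `δ̂^i_{j+1,k} := h(δ̄^i_{j+1})` if `n_i = 1`, and
`δ̂^i_{j+1,k} := (1/n_i)·h(δ̄^i_{j+1}) + (λ^i_{j+1,k} - λ^i_{j+2,k})` if `n_i > 1`,
for `j : Fin (γ i - 1)` and `0 ≤ k ≤ n_i - 1`. -/
def dhatm (nn γ : Fin 3 → ℕ) (jG : ℤ) (i : Fin 3) (j : Fin (γ i - 1)) (k : ℕ) :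
    IdxZ nn γ → ℚ :=
  if nn i = 1 then hIncl nn γ (dbarm γ i j)
  else (1 / (nn i : ℚ)) • hIncl nn γ (dbarm γ i j)
    + (lamZ nn γ jG i ⟨j.val, by have := j.isLt; omega⟩ k
       - lamZ nn γ jG i ⟨j.val + 1, by have := j.isLt; omega⟩ k)

/-- Index set of the family `B̂ = {δ̂_1} ∪ {δ̂^i_{j,k} : 1 ≤ j ≤ γ_i - 1, 0 ≤ k ≤ n_i - 1}`. -/
abbrev IdxB (nn γ : Fin 3 → ℕ) : Type := Unit ⊕ (Σ i : Fin 3, Fin (γ i - 1) × Fin (nn i))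

/-- The family `B̂`. -/
def vecB (nn γ : Fin 3 → ℕ) (jG : ℤ) : IdxB nn γ → (IdxZ nn γ → ℚ)
  | Sum.inl _ => dhat1 nn γ
  | Sum.inr ⟨i, j, k⟩ => dhatm nn γ jG i j k.val

/-- The form on `H_Z` as a bilinear map. -/
noncomputable def formZBilin (nn γ : Fin 3 → ℕ) (jG : ℤ) :
    (IdxZ nn γ → ℚ) →ₗ[ℚ] (IdxZ nn γ → ℚ) →ₗ[ℚ] ℚ :=
  Matrix.toLinearMap₂' ℚ (Matrix.of (gramZ nn γ jG))

theorem formZ_eq_formZBilin (nn γ : Fin 3 → ℕ) (jG : ℤ) (x y : IdxZ nn γ → ℚ) :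
    formZ nn γ jG x y = formZBilin nn γ jG x y := by
  simp only [formZ, formZBilin, Matrix.toLinearMap₂'_apply, Matrix.of_apply, smul_eq_mul]
  exact Finset.sum_congr rfl fun p _ => Finset.sum_congr rfl fun q _ => by ring

theorem formZBilin_single_single (nn γ : Fin 3 → ℕ) (jG : ℤ) (p q : IdxZ nn γ) :
    formZBilin nn γ jG (Pi.single p 1) (Pi.single q 1) = gramZ nn γ jG p q := by
  simp [formZBilin, Matrix.toLinearMap₂'_apply, Pi.single_apply]

theorem hIncl_dbar1 (nn γ : Fin 3 → ℕ) :
    hIncl nn γ (dbar1 γ) = Pi.single (Sum.inl (Sum.inl ())) 1 := by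
  ext (p | p) <;> simp [hIncl, dbar1, Pi.single_apply]

theorem hIncl_dbarm (nn γ : Fin 3 → ℕ) (i : Fin 3) (j : Fin (γ i - 1)) :
    hIncl nn γ (dbarm γ i j) = Pi.single (Sum.inl (Sum.inr ⟨i, j⟩)) 1 := by
  ext (p | p)
  · simp only [hIncl, dbarm, Pi.single_apply, Sum.inl.injEq]
  · simp [hIncl]

/-- The coefficient of the `(m+1)`-st simple root in the weight `λ_k` of `A_{n-1}`. -/
def lamCoeff (n k m : ℕ) : ℚ := ((n : ℚ) - (m + 1)) / n - if m < k then 1 else 0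

theorem sum_fin_mul_ite_eq (N a : ℕ) (f : ℕ → ℚ) (c : ℚ) :
    ∑ q : Fin N, f q * (if a = q.val then c else 0) = if a < N then f a * c else 0 := by
  rw [Fin.sum_univ_eq_sum_range (fun q => f q * (if a = q then c else 0)) N]
  simp

theorem sum_tridiagonal (N m : ℕ) (hm : m < N) (f : ℕ → ℚ) :
    ∑ q : Fin N, f q * (if q.val = m then -2 else if q.val + 1 = m ∨ m + 1 = q.val then 1 else 0)
      = -2 * f m + (if 0 < m then f (m - 1) else 0) + (if m + 1 < N then f (m + 1) else 0) := by
  rw [Fin.sum_univ_eq_sum_range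
    (fun q => f q * (if q = m then -2 else if q + 1 = m ∨ m + 1 = q then 1 else 0)) N]
  have key : ∀ q, f q * (if q = m then -2 else if q + 1 = m ∨ m + 1 = q then 1 else 0)
      = (if q = m then -2 * f q else 0) + (if q = m - 1 then if 0 < m then f q else 0 else 0)
        + (if q = m + 1 then f q else 0) := by
    intro q
    split_ifs <;> first | omega | ring
  have hm' : m - 1 < N := by omega
  simp_rw [key, Finset.sum_add_distrib, Finset.sum_ite_eq', Finset.mem_range, if_pos hm,
    if_pos hm']

theorem sum_lamCoeff_tridiagonal (n k m : ℕ) (hm : m < n - 1) (hk : k ≤ n - 1) :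
    ∑ q : Fin (n - 1), lamCoeff n k q *
        (if q.val = m then -2 else if q.val + 1 = m ∨ m + 1 = q.val then 1 else 0)
      = (if k = m + 1 then 1 else 0) - (if k = m then 1 else 0) := by
  have hn : (n : ℚ) ≠ 0 := by norm_cast; omega
  rw [sum_tridiagonal (n - 1) m hm (lamCoeff n k)]
  have hlast : (if m + 1 < n - 1 then lamCoeff n k (m + 1) else 0) = lamCoeff n k (m + 1) := by
    split_ifs with h
    · rfl
    · have h1 : (n : ℚ) = m + 2 := by norm_cast; omega
      rw [lamCoeff, if_neg (by omega), h1]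
      push_cast
      ring
  rw [hlast]
  rcases m with _ | m
  · simp only [lamCoeff]
    split_ifs <;> first | omega | (push_cast; field_simp; ring)
  · simp only [lamCoeff, Nat.add_sub_cancel]
    split_ifs <;> first | omega | (push_cast; field_simp; ring)

theorem formZBilin_sum_rootZ_rootZ (nn γ : Fin 3 → ℕ) (jG : ℤ) (i i' : Fin 3)
    (j : Fin (γ i)) (j' : Fin (γ i')) (k : ℕ) (hk : k ≤ nn i - 1) (m : Fin (nn i' - 1)) :
    formZBilin nn γ jG (∑ q : Fin (nn i - 1), lamCoeff (nn i) k q • rootZ nn γ i j q)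
        (rootZ nn γ i' j' m)
      = if i = i' ∧ j.val = j'.val then
          (if k = m + 1 then 1 else 0) - (if k = m then 1 else 0) else 0 := by
  simp only [map_sum, map_smul, LinearMap.sum_apply, LinearMap.smul_apply, smul_eq_mul, rootZ,
    formZBilin_single_single, gramZ]
  by_cases h : i = i' ∧ j.val = j'.val
  · simp only [if_pos h]
    obtain ⟨rfl, -⟩ := h
    exact sum_lamCoeff_tridiagonal (nn i) k m m.isLt hk
  · simp [if_neg h]

theorem lamZ_eq_sum (nn γ : Fin 3 → ℕ) (jG : ℤ) (i : Fin 3) (j : Fin (γ i)) (k : ℕ)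
    (hk : k ≤ nn i - 1) :
    lamZ nn γ jG i j k = ∑ q : Fin (nn i - 1), lamCoeff (nn i) k q • rootZ nn γ i j q := by
  induction k with
  | zero =>
    simp only [lamZ, weightZ, Finset.smul_sum, smul_smul, lamCoeff]
    refine Finset.sum_congr rfl fun q _ => ?_
    congr 1
    simp
    ring
  | succ k ih =>
    have h : k < nn i - 1 := by omega
    rw [lamZ, dif_pos h, reflZ, formZ_eq_formZBilin, ih h.le,
      formZBilin_sum_rootZ_rootZ nn γ jG i i j j k h.le]
    have h1 : rootZ nn γ i j ⟨k, h⟩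
        = ∑ q : Fin (nn i - 1), (if q = ⟨k, h⟩ then (1 : ℚ) else 0) • rootZ nn γ i j q := by
      simp
    simp only [and_self, if_true, if_neg (Nat.ne_of_lt (Nat.lt_succ_self k)), zero_sub]
    rw [h1, Finset.smul_sum, ← Finset.sum_add_distrib]
    refine Finset.sum_congr rfl fun q _ => ?_
    rw [smul_smul, ← add_smul]
    congr 1
    simp only [lamCoeff, Fin.ext_iff]
    split_ifs <;> first | omega | ring

theorem formZBilin_lamZ_lamZ (nn γ : Fin 3 → ℕ) (hn : ∀ i, 0 < nn i) (jG : ℤ) (i i' : Fin 3)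
    (j : Fin (γ i)) (j' : Fin (γ i')) (k k' : ℕ) (hk : k ≤ nn i - 1) (hk' : k' ≤ nn i' - 1) :
    formZBilin nn γ jG (lamZ nn γ jG i j k) (lamZ nn γ jG i' j' k')
      = if i = i' ∧ j.val = j'.val then 1 / (nn i : ℚ) - (if k = k' then 1 else 0) else 0 := by
  rw [lamZ_eq_sum nn γ jG i j k hk, lamZ_eq_sum nn γ jG i' j' k' hk', map_sum]
  simp only [map_smul, smul_eq_mul, formZBilin_sum_rootZ_rootZ nn γ jG i i' j j' k hk]
  by_cases h : i = i' ∧ j.val = j'.val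
  · simp only [if_pos h]
    obtain ⟨rfl, -⟩ := h
    have h0 : (nn i : ℚ) ≠ 0 := by exact_mod_cast (hn i).ne'
    have hlast : (if k < nn i - 1 then lamCoeff (nn i) k' k * 1 else 0) = lamCoeff (nn i) k' k := by
      split_ifs with hlt
      · ring
      · have h1 : (nn i : ℚ) = k + 1 := by
          have := hn i
          norm_cast
          omega
        rw [lamCoeff, if_neg (by omega), h1]
        ring
    simp only [mul_sub, Finset.sum_sub_distrib]
    rw [sum_fin_mul_ite_eq (nn i - 1) k (lamCoeff (nn i) k') 1, hlast]
    rcases k with _ | k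
    · simp only [lamCoeff]
      rw [Finset.sum_eq_zero (fun q _ => by simp)]
      split_ifs <;> first | omega | (push_cast; field_simp; ring)
    · simp only [Nat.add_right_cancel_iff]
      rw [sum_fin_mul_ite_eq (nn i - 1) k (lamCoeff (nn i) k') 1, if_pos (by omega)]
      simp only [lamCoeff]
      split_ifs <;> first | omega | (push_cast; field_simp; ring)
  · simp [if_neg h]

theorem formZBilin_inl_lamZ (nn γ : Fin 3 → ℕ) (jG : ℤ) (p : IdxW γ) (i : Fin 3)
    (j : Fin (γ i)) (k : ℕ) (hk : k ≤ nn i - 1) :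
    formZBilin nn γ jG (Pi.single (Sum.inl p) 1) (lamZ nn γ jG i j k) = 0 := by
  rw [lamZ_eq_sum nn γ jG i j k hk]
  simp only [map_sum, map_smul, rootZ, formZBilin_single_single, gramZ, smul_zero,
    Finset.sum_const_zero]

theorem formZBilin_lamZ_inl (nn γ : Fin 3 → ℕ) (jG : ℤ) (p : IdxW γ) (i : Fin 3)
    (j : Fin (γ i)) (k : ℕ) (hk : k ≤ nn i - 1) :
    formZBilin nn γ jG (lamZ nn γ jG i j k) (Pi.single (Sum.inl p) 1) = 0 := by
  rw [lamZ_eq_sum nn γ jG i j k hk]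
  simp only [map_sum, map_smul, LinearMap.sum_apply, LinearMap.smul_apply, rootZ,
    formZBilin_single_single, gramZ, smul_zero, Finset.sum_const_zero]

theorem lamZ_inl (nn γ : Fin 3 → ℕ) (jG : ℤ) (p : IdxW γ) (i : Fin 3)
    (j : Fin (γ i)) (k : ℕ) (hk : k ≤ nn i - 1) :
    lamZ nn γ jG i j k (Sum.inl p) = 0 := by
  rw [lamZ_eq_sum nn γ jG i j k hk]
  simp [rootZ]

theorem dhatm_eq (nn γ : Fin 3 → ℕ) (jG : ℤ) (i : Fin 3) (j : Fin (γ i - 1)) (k : ℕ)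
    (hk : k ≤ nn i - 1) :
    dhatm nn γ jG i j k = (1 / (nn i : ℚ)) • Pi.single (Sum.inl (Sum.inr ⟨i, j⟩)) 1
      + (lamZ nn γ jG i ⟨j.val, by have := j.isLt; omega⟩ k
         - lamZ nn γ jG i ⟨j.val + 1, by have := j.isLt; omega⟩ k) := by
  rw [dhatm, hIncl_dbarm]
  split_ifs with h
  · have : IsEmpty (Fin (nn i - 1)) := ⟨fun q => by have := q.isLt; omega⟩
    rw [lamZ_eq_sum _ _ _ _ _ _ hk, lamZ_eq_sum _ _ _ _ _ _ hk]
    simp [h]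
  · rfl

theorem formZ_dhat1_dhatm (nn γ : Fin 3 → ℕ) (hn : ∀ i, 0 < nn i) (jG : ℤ) (i : Fin 3)
    (j : Fin (γ i - 1)) (k : ℕ) (hk : k ≤ nn i - 1) :
    formZ nn γ jG (dhat1 nn γ) (dhatm nn γ jG i j k) = if j.val = 0 then 1 else 0 := by
  have h0 : (nn i : ℚ) ≠ 0 := by exact_mod_cast (hn i).ne'
  rw [formZ_eq_formZBilin, dhat1, hIncl_dbar1, dhatm_eq _ _ _ _ _ _ hk]
  simp only [map_add, map_sub, map_smul, formZBilin_inl_lamZ _ _ _ _ _ _ _ hk,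
    formZBilin_single_single, gramZ, gramW, smul_eq_mul]
  split_ifs <;> simp [h0]

theorem formZ_dhatm_dhatm (nn γ : Fin 3 → ℕ) (hn : ∀ i, 0 < nn i) (jG : ℤ) (i i' : Fin 3)
    (j : Fin (γ i - 1)) (j' : Fin (γ i' - 1)) (k k' : ℕ)
    (hk : k ≤ nn i - 1) (hk' : k' ≤ nn i' - 1) :
    formZ nn γ jG (dhatm nn γ jG i j k) (dhatm nn γ jG i' j' k')
      = if i = i' ∧ k = k' then
          (if j.val = j'.val then -2
           else if j.val + 1 = j'.val ∨ j'.val + 1 = j.val then 1 else 0)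
        else 0 := by
  have h0 : (nn i : ℚ) ≠ 0 := by exact_mod_cast (hn i).ne'
  rw [formZ_eq_formZBilin, dhatm_eq _ _ _ _ _ _ hk, dhatm_eq _ _ _ _ _ _ hk']
  simp only [map_add, map_sub, map_smul, LinearMap.add_apply, LinearMap.sub_apply,
    LinearMap.smul_apply, formZBilin_inl_lamZ _ _ _ _ _ _ _ hk',
    formZBilin_lamZ_inl _ _ _ _ _ _ _ hk, formZBilin_lamZ_lamZ nn γ hn jG _ _ _ _ _ _ hk hk',
    formZBilin_single_single, gramZ, gramW, smul_eq_mul]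
  by_cases hi : i = i'
  · subst hi
    simp only [true_and, if_true]
    split_ifs <;> first | omega | (field_simp; ring)
  · simp [hi]

/-- A family of functionals on `H_Z` dual to `B̂`. -/
noncomputable def dualB (nn γ : Fin 3 → ℕ) (jG : ℤ) :
    IdxB nn γ → Module.Dual ℚ (IdxZ nn γ → ℚ)
  | Sum.inl _ => LinearMap.proj (Sum.inl (Sum.inl ()))
  | Sum.inr ⟨i, j, k⟩ =>
      LinearMap.proj (Sum.inl (Sum.inr ⟨i, j⟩))
        - ∑ l : Fin (γ i), (if l.val ≤ j.val then (1 : ℚ) else 0) •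
            (formZBilin nn γ jG).flip (lamZ nn γ jG i l k)

theorem dualB_vecB (nn γ : Fin 3 → ℕ) (hn : ∀ i, 0 < nn i) (jG : ℤ) (a b : IdxB nn γ) :
    dualB nn γ jG a (vecB nn γ jG b) = if a = b then 1 else 0 := by
  rcases a with ⟨⟩ | ⟨i, j, k⟩ <;> rcases b with ⟨⟩ | ⟨i', j', k'⟩
  · simp [dualB, vecB, dhat1, hIncl_dbar1]
  · have hk' : k'.val ≤ nn i' - 1 := by omega
    simp [dualB, vecB, dhatm_eq _ _ _ _ _ _ hk', lamZ_inl _ _ _ _ _ _ _ hk']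
  · have hk : k.val ≤ nn i - 1 := by omega
    simp only [dualB, vecB, dhat1, hIncl_dbar1, LinearMap.sub_apply, LinearMap.sum_apply,
      LinearMap.smul_apply, LinearMap.flip_apply, LinearMap.proj_apply,
      formZBilin_inl_lamZ _ _ _ _ _ _ _ hk]
    simp
  · have hk : k.val ≤ nn i - 1 := by omega
    have hk' : k'.val ≤ nn i' - 1 := by omega
    simp only [dualB, vecB, dhatm_eq _ _ _ _ _ _ hk', LinearMap.sub_apply, LinearMap.sum_apply,
      LinearMap.smul_apply, LinearMap.flip_apply, LinearMap.proj_apply, map_add, map_sub,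
      map_smul, 
      lamZ_inl _ _ _ _ _ _ _ hk', formZBilin_inl_lamZ _ _ _ _ _ _ _ hk,
      formZBilin_lamZ_lamZ nn γ hn jG _ _ _ _ _ _ hk' hk, smul_eq_mul, Pi.single_apply]
    by_cases hi : i = i'
    · subst hi
      have hj : j'.val < γ i := by have := j'.isLt; omega
      have hj1 : j'.val + 1 < γ i := by have := j'.isLt; omega
      simp only [true_and, mul_zero, Finset.sum_const_zero, Sum.inl.injEq, Sum.inr.injEq,
        Sigma.mk.injEq, heq_eq_eq, Prod.mk.injEq, Fin.ext_iff]
      rw [sum_fin_mul_ite_eq (γ i) j' (fun l => if l ≤ j.val then 1 else 0),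
        sum_fin_mul_ite_eq (γ i) (j' + 1) (fun l => if l ≤ j.val then 1 else 0),
        if_pos hj, if_pos hj1]
      split_ifs <;> first | omega | ring
    · have hi' : ¬ i' = i := fun h => hi h.symm
      simp [hi', hi]

/-- In the concrete model `H_Z`, the family
`B̂ = {δ̂_1} ∪ {δ̂^i_{j,k}}`, consisting of `1 + Σᵢ n_i·(γ_i - 1)` vectors, is linearly
independent over `ℚ`, and its Gram matrix is star-shaped:  `⟨δ̂_1, δ̂_1⟩ = 2j_G - 2`; every
`δ̂^i_{j,k}` has self-pairing `-2`; `⟨δ̂_1, δ̂^i_{1,k}⟩ = 1` and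
`⟨δ̂^i_{j,k}, δ̂^i_{j+1,k}⟩ = 1`; and all other pairs among `B̂` pair to `0`. -/
theorem vecB_linearIndependent_and_star_shaped
    (nn γ : Fin 3 → ℕ) (hn : ∀ i, 0 < nn i) (hγ : ∀ i, 0 < γ i) (jG : ℤ) :
    Fintype.card (IdxB nn γ) = 1 + ∑ i : Fin 3, nn i * (γ i - 1) ∧
    LinearIndependent ℚ (vecB nn γ jG) ∧
    formZ nn γ jG (dhat1 nn γ) (dhat1 nn γ) = 2 * (jG : ℚ) - 2 ∧
    (∀ i, ∀ j : Fin (γ i - 1), ∀ k : ℕ, k ≤ nn i - 1 →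
      formZ nn γ jG (dhatm nn γ jG i j k) (dhatm nn γ jG i j k) = -2) ∧
    (∀ i, ∀ h1 : 0 < γ i - 1, ∀ k : ℕ, k ≤ nn i - 1 →
      formZ nn γ jG (dhat1 nn γ) (dhatm nn γ jG i ⟨0, h1⟩ k) = 1) ∧
    (∀ i, ∀ j j' : Fin (γ i - 1), j.val + 1 = j'.val → ∀ k : ℕ, k ≤ nn i - 1 →
      formZ nn γ jG (dhatm nn γ jG i j k) (dhatm nn γ jG i j' k) = 1) ∧
    (∀ i, ∀ j : Fin (γ i - 1), ∀ k : ℕ, 1 ≤ j.val → k ≤ nn i - 1 →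
      formZ nn γ jG (dhat1 nn γ) (dhatm nn γ jG i j k) = 0) ∧
    (∀ i i', ∀ j : Fin (γ i - 1), ∀ j' : Fin (γ i' - 1), ∀ k k' : ℕ,
      k ≤ nn i - 1 → k' ≤ nn i' - 1 →
      ¬(i = i' ∧ j.val = j'.val ∧ k = k') →
      ¬(i = i' ∧ k = k' ∧ (j.val + 1 = j'.val ∨ j'.val + 1 = j.val)) →
      formZ nn γ jG (dhatm nn γ jG i j k) (dhatm nn γ jG i' j' k') = 0) := by
  refine ⟨by simp [Fintype.card_sum, Fintype.card_sigma, mul_comm], ?_, ?_, ?_, ?_, ?_, ?_, ?_⟩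
  · exact LinearIndependent.of_pairwise_dual_eq_zero_one _ (dualB nn γ jG)
      (fun a b hab => (dualB_vecB nn γ hn jG a b).trans (if_neg hab))
      (fun a => (dualB_vecB nn γ hn jG a a).trans (if_pos rfl))
  · rw [formZ_eq_formZBilin, dhat1, hIncl_dbar1, formZBilin_single_single]
    rfl
  · intro i j k hk
    simp [formZ_dhatm_dhatm nn γ hn jG i i j j k k hk hk]
  · intro i h1 k hk
    simp [formZ_dhat1_dhatm nn γ hn jG i _ k hk]
  · intro i j j' hj k hk
    rw [formZ_dhatm_dhatm nn γ hn jG i i j j' k k hk hk, if_pos ⟨rfl, rfl⟩, if_neg (by omega),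
      if_pos (Or.inl hj)]
  · intro i j k hj hk
    rw [formZ_dhat1_dhatm nn γ hn jG i j k hk, if_neg (by omega)]
  · intro i i' j j' k k' hk hk' h1 h2
    rw [formZ_dhatm_dhatm nn γ hn jG i i' j j' k k' hk hk']
    split_ifs <;> tauto
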